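/- arXiv:2208.03925 — 2 statements merged into one kernel-verified Lean document; each statement's English description precedes it below -/
import Mathlib

section
/- Deduction Theorem for DC: for every finite set of formulas Γ and all formulas A, B, the datum {{¬A∨B}} is DC-deducible from the one-component datum {Γ} if and only if the datum {{B}} is DC-deducible from the one-component datum {Γ∪{A}}. -/
/-- Formulas of classical propositional logic: propositional variables,
negation, conjunction, disjunction. -/
inductive Fml : Type
  | var : ℕ → Fml
  | neg : Fml → Fml
  | conj : Fml → Fml → Fml
  | disj : Fml → Fml → Fml
  deriving DecidableEq

/-- A datum: a finite set of finite sets (components) of formulas. -/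
abbrev Datum := Finset (Finset Fml)

/-- Truth-value of a formula under an interpretation of the variables. -/
def Fml.eval (v : ℕ → Bool) : Fml → Bool
  | .var n => v n
  | .neg A => !A.eval v
  | .conj A B => A.eval v && B.eval v
  | .disj A B => A.eval v || B.eval v

/-- An interpretation verifies a datum iff some component has all its
formulas true. -/
def Verifies (v : ℕ → Bool) (α : Datum) : Prop :=
  ∃ Γ ∈ α, ∀ A ∈ Γ, A.eval v = true

/-- The analytic G-rules of the Data Calculus DC. -/
inductive GStep : Datum → Datum → Prop
  | conj (Γ : Finset Fml) (A B : Fml) (ρ : Datum) :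
      GStep (insert (insert (Fml.conj A B) Γ) ρ)
            (insert (insert A (insert B Γ)) ρ)
  | disj (Γ : Finset Fml) (A B : Fml) (ρ : Datum) :
      GStep (insert (insert (Fml.disj A B) Γ) ρ)
            (insert (insert A Γ) (insert (insert B Γ) ρ))
  | negneg (Γ : Finset Fml) (A : Fml) (ρ : Datum) :
      GStep (insert (insert (Fml.neg (Fml.neg A)) Γ) ρ)
            (insert (insert A Γ) ρ)
  | negdisj (Γ : Finset Fml) (A B : Fml) (ρ : Datum) :
      GStep (insert (insert (Fml.neg (Fml.disj A B)) Γ) ρ)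
            (insert (insert (Fml.neg A) (insert (Fml.neg B) Γ)) ρ)
  | negconj (Γ : Finset Fml) (A B : Fml) (ρ : Datum) :
      GStep (insert (insert (Fml.neg (Fml.conj A B)) Γ) ρ)
            (insert (insert (Fml.neg A) Γ) (insert (insert (Fml.neg B) Γ) ρ))

/-- The analytic N-rule NC: delete a component containing a pair A, ¬A. -/
def NCStep (α β : Datum) : Prop :=
  ∃ (Γ : Finset Fml) (A : Fml),
    α = insert (insert A (insert (Fml.neg A) Γ)) β

/-- The synthetic N-rule EM: replace a component Γ by the two components
Γ∪{A} and Γ∪{¬A}. -/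
def EMStep (α β : Datum) : Prop :=
  ∃ (Γ : Finset Fml) (A : Fml) (ρ : Datum),
    α = insert Γ ρ ∧
    β = insert (insert A Γ) (insert (insert (Fml.neg A) Γ) ρ)

/-- The analytic S-rule Del: replace a component Γ∪Δ by its subset Γ. -/
def DelStep (α β : Datum) : Prop :=
  ∃ (Γ Δ : Finset Fml) (ρ : Datum),
    α = insert (Γ ∪ Δ) ρ ∧ β = insert Γ ρ

/-- The synthetic S-rule Exp: add an arbitrary new component. -/
def ExpStep (α β : Datum) : Prop :=
  ∃ Γ : Finset Fml, β = insert Γ α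

/-- One step of the Data Calculus DC. -/
def DCStep (α β : Datum) : Prop :=
  GStep α β ∨ GStep β α ∨ NCStep α β ∨ EMStep α β ∨ DelStep α β ∨ ExpStep α β

theorem gstep_union (γ α β : Datum) (h : GStep α β) : GStep (α ∪ γ) (β ∪ γ) := by
  cases h <;> simp only [Finset.insert_union] <;> constructor

theorem dcstep_union (γ α β : Datum) (h : DCStep α β) : DCStep (α ∪ γ) (β ∪ γ) := by
  rcases h with h | h | ⟨Γ, A, rfl⟩ | ⟨Γ, A, ρ, rfl, rfl⟩ | ⟨Γ, Δ, ρ, rfl, rfl⟩ | ⟨Γ, rfl⟩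
  · exact Or.inl (gstep_union γ _ _ h)
  · exact Or.inr (Or.inl (gstep_union γ _ _ h))
  · exact Or.inr (Or.inr (Or.inl ⟨Γ, A, by simp only [Finset.insert_union]⟩))
  · exact Or.inr (Or.inr (Or.inr (Or.inl ⟨Γ, A, ρ ∪ γ, by simp only [Finset.insert_union],
      by simp only [Finset.insert_union]⟩)))
  · exact Or.inr (Or.inr (Or.inr (Or.inr (Or.inl ⟨Γ, Δ, ρ ∪ γ, by simp only [Finset.insert_union],
      by simp only [Finset.insert_union]⟩))))
  · exact Or.inr (Or.inr (Or.inr (Or.inr (Or.inr ⟨Γ, by simp only [Finset.insert_union]⟩))))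

theorem gstep_image (C : Fml) (α β : Datum) (h : GStep α β) :
    GStep (α.image (insert C)) (β.image (insert C)) := by
  cases h with
  | conj Γ A B ρ =>
    have := GStep.conj (insert C Γ) A B (ρ.image (insert C))
    simpa only [Finset.image_insert, Finset.insert_comm C] using this
  | disj Γ A B ρ =>
    have := GStep.disj (insert C Γ) A B (ρ.image (insert C))
    simpa only [Finset.image_insert, Finset.insert_comm C] using this
  | negneg Γ A ρ =>
    have := GStep.negneg (insert C Γ) A (ρ.image (insert C))
    simpa only [Finset.image_insert, Finset.insert_comm C] using this
  | negdisj Γ A B ρ =>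
    have := GStep.negdisj (insert C Γ) A B (ρ.image (insert C))
    simpa only [Finset.image_insert, Finset.insert_comm C] using this
  | negconj Γ A B ρ =>
    have := GStep.negconj (insert C Γ) A B (ρ.image (insert C))
    simpa only [Finset.image_insert, Finset.insert_comm C] using this

theorem dcstep_image (C : Fml) (α β : Datum) (h : DCStep α β) :
    DCStep (α.image (insert C)) (β.image (insert C)) := by
  rcases h with h | h | ⟨Γ, A, rfl⟩ | ⟨Γ, A, ρ, rfl, rfl⟩ | ⟨Γ, Δ, ρ, rfl, rfl⟩ | ⟨Γ, rfl⟩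
  · exact Or.inl (gstep_image C _ _ h)
  · exact Or.inr (Or.inl (gstep_image C _ _ h))
  · refine Or.inr (Or.inr (Or.inl ⟨insert C Γ, A, ?_⟩))
    simp only [Finset.image_insert, Finset.insert_comm C]
  · refine Or.inr (Or.inr (Or.inr (Or.inl ⟨insert C Γ, A, ρ.image (insert C), ?_, ?_⟩)))
    · simp only [Finset.image_insert]
    · simp only [Finset.image_insert, Finset.insert_comm C]
  · refine Or.inr (Or.inr (Or.inr (Or.inr (Or.inl
      ⟨insert C Γ, Δ, ρ.image (insert C), ?_, ?_⟩))))
    · simp only [Finset.image_insert, Finset.insert_union]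
    · simp only [Finset.image_insert]
  · refine Or.inr (Or.inr (Or.inr (Or.inr (Or.inr ⟨insert C Γ, ?_⟩))))
    simp only [Finset.image_insert]

/-- Deduction Theorem for DC: {{¬A∨B}} is DC-deducible from the
one-component datum {Γ} iff {{B}} is DC-deducible from the one-component
datum {Γ∪{A}}. -/
theorem dc_deduction_theorem (Γ : Finset Fml) (A B : Fml) :
    Relation.ReflTransGen DCStep ({Γ} : Datum)
        ({{Fml.disj (Fml.neg A) B}} : Datum) ↔
      Relation.ReflTransGen DCStep ({insert A Γ} : Datum) ({{B}} : Datum) := by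
  constructor
  · intro h
    have h1 := Relation.ReflTransGen.lift (fun α : Datum => α.image (insert A))
      (dcstep_image A) _ _ h
    simp only [Function.onFun, Finset.image_singleton] at h1
    have s1 : DCStep {insert A {Fml.disj (Fml.neg A) B}}
        {insert A {Fml.neg A}, insert A {B}} := by
      have := GStep.disj {A} (Fml.neg A) B ∅
      refine Or.inl ?_
      rw [Finset.pair_comm A, Finset.pair_comm A, Finset.pair_comm A]
      exact this
    have s2 : DCStep {insert A {Fml.neg A}, insert A {B}} {insert A {B}} :=
      Or.inr (Or.inr (Or.inl ⟨∅, A, rfl⟩))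
    have s3 : DCStep {insert A {B}} {{B}} := by
      refine Or.inr (Or.inr (Or.inr (Or.inr (Or.inl ⟨{B}, {A}, ∅, ?_, rfl⟩))))
      rw [Finset.union_comm]; rfl
    exact ((h1.tail s1).tail s2).tail s3
  · intro h
    have h1 := Relation.ReflTransGen.lift
      (fun α : Datum => α ∪ {insert (Fml.neg A) Γ}) (dcstep_union _) _ _ h
    have s0 : DCStep {Γ} ({insert A Γ} ∪ {insert (Fml.neg A) Γ}) :=
      Or.inr (Or.inr (Or.inr (Or.inl ⟨Γ, A, ∅, rfl, rfl⟩)))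
    have s1 : DCStep ({{B}} ∪ {insert (Fml.neg A) Γ}) {{Fml.neg A}, {B}} := by
      refine Or.inr (Or.inr (Or.inr (Or.inr (Or.inl ⟨{Fml.neg A}, Γ, {{B}}, ?_, rfl⟩))))
      rw [Finset.union_comm]; rfl
    have s2 : DCStep {{Fml.neg A}, {B}} {{Fml.disj (Fml.neg A) B}} :=
      Or.inr (Or.inl (GStep.disj ∅ (Fml.neg A) B ∅))
    exact (((Relation.ReflTransGen.single s0).trans h1).tail s1).tail s2
end

section
/- Herbrand's theorem, validity form: let A be a quantifier-free, equality-free first-order formula with free variables among x₁,…,xₙ. Then the existential closure ∃x₁…∃xₙ A is valid (true in every structure with nonempty domain) if and only if the set Γ of all Herbrand instances of A (with respect to the function symbols occurring in A) is propositionally disjunctively valid, i.e. every propositional interpretation makes at least one member of Γ true. -/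
/-- First-order terms over a family `Fn` of function symbols (with `Fn n` the
`n`-ary symbols; 0-ary symbols are constants), with individual variables
indexed by ℕ. -/
inductive Term (Fn : ℕ → Type) : Type
  | var : ℕ → Term Fn
  | app : {n : ℕ} → Fn n → (Fin n → Term Fn) → Term Fn

/-- Quantifier-free, equality-free first-order formulas over function symbols
`Fn` and relation symbols `Rl`. -/
inductive QFForm (Fn Rl : ℕ → Type) : Type
  | atom : {n : ℕ} → Rl n → (Fin n → Term Fn) → QFForm Fn Rl
  | neg : QFForm Fn Rl → QFForm Fn Rl
  | conj : QFForm Fn Rl → QFForm Fn Rl → QFForm Fn Rl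
  | disj : QFForm Fn Rl → QFForm Fn Rl → QFForm Fn Rl

variable {Fn Rl : ℕ → Type}

/-- The variable `x` occurs in a term. -/
inductive Term.UsesVar : Term Fn → ℕ → Prop
  | var (x : ℕ) : Term.UsesVar (.var x) x
  | app {n : ℕ} (f : Fn n) (ts : Fin n → Term Fn) (i : Fin n) (x : ℕ) :
      Term.UsesVar (ts i) x → Term.UsesVar (.app f ts) x

/-- The variable `x` occurs (free) in a quantifier-free formula. -/
inductive QFForm.UsesVar : QFForm Fn Rl → ℕ → Prop
  | atom {n : ℕ} (R : Rl n) (ts : Fin n → Term Fn) (i : Fin n) (x : ℕ) :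
      Term.UsesVar (ts i) x → QFForm.UsesVar (.atom R ts) x
  | neg (A : QFForm Fn Rl) (x : ℕ) :
      QFForm.UsesVar A x → QFForm.UsesVar (.neg A) x
  | conjL (A B : QFForm Fn Rl) (x : ℕ) :
      QFForm.UsesVar A x → QFForm.UsesVar (.conj A B) x
  | conjR (A B : QFForm Fn Rl) (x : ℕ) :
      QFForm.UsesVar B x → QFForm.UsesVar (.conj A B) x
  | disjL (A B : QFForm Fn Rl) (x : ℕ) :
      QFForm.UsesVar A x → QFForm.UsesVar (.disj A B) x
  | disjR (A B : QFForm Fn Rl) (x : ℕ) :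
      QFForm.UsesVar B x → QFForm.UsesVar (.disj A B) x

/-- The function symbol `f` occurs in a term. -/
inductive Term.UsesFn : Term Fn → ∀ n : ℕ, Fn n → Prop
  | here {n : ℕ} (f : Fn n) (ts : Fin n → Term Fn) :
      Term.UsesFn (.app f ts) n f
  | there {n : ℕ} (f : Fn n) (ts : Fin n → Term Fn) (i : Fin n)
      {m : ℕ} (g : Fn m) :
      Term.UsesFn (ts i) m g → Term.UsesFn (.app f ts) m g

/-- The function symbol `f` occurs in a quantifier-free formula. -/
inductive QFForm.UsesFn : QFForm Fn Rl → ∀ n : ℕ, Fn n → Prop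
  | atom {n : ℕ} (R : Rl n) (ts : Fin n → Term Fn) (i : Fin n)
      {m : ℕ} (g : Fn m) :
      Term.UsesFn (ts i) m g → QFForm.UsesFn (.atom R ts) m g
  | neg (A : QFForm Fn Rl) {m : ℕ} (g : Fn m) :
      QFForm.UsesFn A m g → QFForm.UsesFn (.neg A) m g
  | conjL (A B : QFForm Fn Rl) {m : ℕ} (g : Fn m) :
      QFForm.UsesFn A m g → QFForm.UsesFn (.conj A B) m g
  | conjR (A B : QFForm Fn Rl) {m : ℕ} (g : Fn m) :
      QFForm.UsesFn B m g → QFForm.UsesFn (.conj A B) m g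
  | disjL (A B : QFForm Fn Rl) {m : ℕ} (g : Fn m) :
      QFForm.UsesFn A m g → QFForm.UsesFn (.disj A B) m g
  | disjR (A B : QFForm Fn Rl) {m : ℕ} (g : Fn m) :
      QFForm.UsesFn B m g → QFForm.UsesFn (.disj A B) m g

/-- A term is built from individual variables and function symbols
satisfying `P` only. -/
inductive Term.OnlyFns (P : ∀ n : ℕ, Fn n → Prop) : Term Fn → Prop
  | var (x : ℕ) : Term.OnlyFns P (.var x)
  | app {n : ℕ} (f : Fn n) (ts : Fin n → Term Fn) :
      P n f → (∀ i, Term.OnlyFns P (ts i)) → Term.OnlyFns P (.app f ts)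

/-- Uniform substitution of terms for variables, in a term. -/
def Term.subst (θ : ℕ → Term Fn) : Term Fn → Term Fn
  | .var x => θ x
  | .app f ts => .app f fun i => (ts i).subst θ

/-- Uniform substitution of terms for (the free occurrences of) variables,
in a quantifier-free formula. -/
def QFForm.subst (θ : ℕ → Term Fn) : QFForm Fn Rl → QFForm Fn Rl
  | .atom R ts => .atom R fun i => (ts i).subst θ
  | .neg A => .neg (A.subst θ)
  | .conj A B => .conj (A.subst θ) (B.subst θ)
  | .disj A B => .disj (A.subst θ) (B.subst θ)

/-- Evaluation of a term in a structure with domain `D`, function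
interpretation `fI` and variable assignment `v`. -/
def Term.eval {D : Type} (fI : ∀ n : ℕ, Fn n → (Fin n → D) → D)
    (v : ℕ → D) : Term Fn → D
  | .var x => v x
  | .app f ts => fI _ f fun i => (ts i).eval fI v

/-- Truth of a quantifier-free formula in a structure (domain `D`, function
interpretation `fI`, relation interpretation `rI`) under an assignment `v`. -/
def QFForm.eval {D : Type} (fI : ∀ n : ℕ, Fn n → (Fin n → D) → D)
    (rI : ∀ n : ℕ, Rl n → (Fin n → D) → Prop) (v : ℕ → D) :
    QFForm Fn Rl → Prop
  | .atom R ts => rI _ R fun i => (ts i).eval fI v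
  | .neg A => ¬ A.eval fI rI v
  | .conj A B => A.eval fI rI v ∧ B.eval fI rI v
  | .disj A B => A.eval fI rI v ∨ B.eval fI rI v

/-- Truth-functional evaluation of a quantifier-free formula under a
propositional interpretation `π`, which assigns a truth-value to every
atomic formula. -/
def QFForm.evalProp (π : ∀ n : ℕ, Rl n → (Fin n → Term Fn) → Prop) :
    QFForm Fn Rl → Prop
  | .atom R ts => π _ R ts
  | .neg A => ¬ A.evalProp π
  | .conj A B => A.evalProp π ∧ B.evalProp π
  | .disj A B => A.evalProp π ∨ B.evalProp π

/-- `θ` is a Herbrand substitution for the variables below `n`, with respect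
to the function symbols satisfying `P`: it substitutes, for each variable
below `n`, a term built from individual variables and function symbols
satisfying `P`, and leaves all other variables unchanged. -/
def HerbrandSubst (P : ∀ n : ℕ, Fn n → Prop) (n : ℕ) (θ : ℕ → Term Fn) : Prop :=
  (∀ x, x < n → (θ x).OnlyFns P) ∧ ∀ x, n ≤ x → θ x = .var x

theorem Term.eval_subst_aux {D : Type} (fI : ∀ n : ℕ, Fn n → (Fin n → D) → D)
    (v : ℕ → D) (θ : ℕ → Term Fn) (t : Term Fn) :
    (t.subst θ).eval fI v = t.eval fI (fun x => (θ x).eval fI v) := by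
  induction t with
  | var x => rfl
  | app f ts ih => simp only [Term.subst, Term.eval, ih]

theorem QFForm.evalProp_subst_aux {D : Type} (fI : ∀ n : ℕ, Fn n → (Fin n → D) → D)
    (rI : ∀ n : ℕ, Rl n → (Fin n → D) → Prop)
    (v : ℕ → D) (θ : ℕ → Term Fn) (A : QFForm Fn Rl) :
    (A.subst θ).evalProp (fun _ R ts => rI _ R fun i => (ts i).eval fI v) ↔
      A.eval fI rI (fun x => (θ x).eval fI v) := by
  induction A with
  | atom R ts => simp only [QFForm.subst, QFForm.evalProp, QFForm.eval, Term.eval_subst_aux]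
  | neg A ih => simp only [QFForm.subst, QFForm.evalProp, QFForm.eval, ih]
  | conj A B ih1 ih2 => simp only [QFForm.subst, QFForm.evalProp, QFForm.eval, ih1, ih2]
  | disj A B ih1 ih2 => simp only [QFForm.subst, QFForm.evalProp, QFForm.eval, ih1, ih2]

open Classical in
/-- Function interpretation in the Herbrand structure. -/
noncomputable def herbFI (P : ∀ n : ℕ, Fn n → Prop) (n : ℕ) (f : Fn n)
    (ts : Fin n → {t : Term Fn // t.OnlyFns P}) : {t : Term Fn // t.OnlyFns P} :=
  if h : P n f then ⟨.app f fun i => (ts i).1, .app f _ h fun i => (ts i).2⟩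
  else ⟨.var 0, .var 0⟩

theorem Term.herb_eval (P : ∀ n : ℕ, Fn n → Prop) (v : ℕ → {t : Term Fn // t.OnlyFns P})
    (θ : ℕ → Term Fn) (t : Term Fn) (hP : ∀ m f, t.UsesFn m f → P m f)
    (hv : ∀ x, t.UsesVar x → θ x = (v x).1) :
    (t.eval (herbFI P) v).1 = t.subst θ := by
  induction t with
  | var x => exact (hv x (.var x)).symm
  | app f ts ih =>
    have h : P _ f := hP _ _ (.here f ts)
    simp only [Term.eval, Term.subst, herbFI, dif_pos h]
    congr 1
    funext i
    exact ih i (fun m g hg => hP m g (.there f ts i g hg))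
      (fun x hx => hv x (.app f ts i x hx))

theorem QFForm.herb_eval (P : ∀ n : ℕ, Fn n → Prop) (v : ℕ → {t : Term Fn // t.OnlyFns P})
    (π : ∀ m : ℕ, Rl m → (Fin m → Term Fn) → Prop)
    (θ : ℕ → Term Fn) (A : QFForm Fn Rl) (hP : ∀ m f, A.UsesFn m f → P m f)
    (hv : ∀ x, A.UsesVar x → θ x = (v x).1) :
    A.eval (herbFI P) (fun m R ts => π m R fun i => (ts i).1) v ↔ (A.subst θ).evalProp π := by
  induction A with
  | atom R ts =>
    simp only [QFForm.subst, QFForm.evalProp, QFForm.eval]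
    have : (fun i => ((ts i).eval (herbFI P) v).1) = fun i => (ts i).subst θ := by
      funext i
      exact Term.herb_eval P v θ (ts i) (fun m g hg => hP m g (.atom R ts i g hg))
        (fun x hx => hv x (.atom R ts i x hx))
    rw [this]
  | neg A ih =>
    exact not_congr (ih (fun m g hg => hP m g (.neg A g hg)) (fun x hx => hv x (.neg A x hx)))
  | conj A B ih1 ih2 =>
    exact and_congr
      (ih1 (fun m g hg => hP m g (.conjL A B g hg)) (fun x hx => hv x (.conjL A B x hx)))
      (ih2 (fun m g hg => hP m g (.conjR A B g hg)) (fun x hx => hv x (.conjR A B x hx)))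
  | disj A B ih1 ih2 =>
    exact or_congr
      (ih1 (fun m g hg => hP m g (.disjL A B g hg)) (fun x hx => hv x (.disjL A B x hx)))
      (ih2 (fun m g hg => hP m g (.disjR A B g hg)) (fun x hx => hv x (.disjR A B x hx)))

/-- Herbrand's theorem, validity form: for quantifier-free, equality-free `A`
with free variables among the first `n` variables, the existential closure
of `A` is valid (true in every structure with nonempty domain) iff the set
of all Herbrand instances of `A` (with respect to the function symbols
occurring in `A`) is propositionally disjunctively valid: every
propositional interpretation makes at least one Herbrand instance true. -/
theorem herbrand_validity (Fn Rl : ℕ → Type) (A : QFForm Fn Rl)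
    (n : ℕ) (hfree : ∀ x, A.UsesVar x → x < n) :
    (∀ (D : Type), Nonempty D →
      ∀ (fI : ∀ m : ℕ, Fn m → (Fin m → D) → D)
        (rI : ∀ m : ℕ, Rl m → (Fin m → D) → Prop),
        ∃ v : ℕ → D, A.eval fI rI v) ↔
    (∀ π : ∀ m : ℕ, Rl m → (Fin m → Term Fn) → Prop,
      ∃ θ : ℕ → Term Fn, HerbrandSubst (fun m f => A.UsesFn m f) n θ ∧
        (A.subst θ).evalProp π) := by
  constructor
  · intro H π
    obtain ⟨v, hv⟩ := H {t : Term Fn // t.OnlyFns (fun m f => A.UsesFn m f)} ⟨⟨.var 0, .var 0⟩⟩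
      (herbFI _) (fun m R ts => π m R fun i => (ts i).1)
    refine ⟨fun x => if x < n then (v x).1 else .var x, ⟨?_, ?_⟩, ?_⟩
    · intro x hx
      simp only [if_pos hx]
      exact (v x).2
    · intro x hx
      exact if_neg (not_lt.mpr hx)
    · refine (QFForm.herb_eval _ v π _ A (fun _ _ h => h) ?_).1 hv
      intro x hx
      exact if_pos (hfree x hx)
  · rintro H D ⟨d⟩ fI rI
    obtain ⟨θ, -, h⟩ := H (fun _ R ts => rI _ R fun i => (ts i).eval fI (fun _ => d))
    exact ⟨_, (QFForm.evalProp_subst_aux fI rI _ θ A).1 h⟩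
end
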